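/- arXiv:1304.5615 — 2 statements merged into one kernel-verified Lean document; each statement's English description precedes it below -/
import Mathlib

section
/- Fix an increasing sequence (k_n)_{n≥1} of positive integers with k_n ≤ n for all n and k_n → ∞. The number T_n of equivalence classes of and/or trees of size n whose leaf labels use at most k_n distinct variables satisfies T_n = C_{n-1} · Σ_{p=1}^{k_n} S(n,p) · 2^{2n−1−p}, where C_{n-1} is the (n−1)-st Catalan number (the number of binary plane trees with n leaves) and S(n,p) is the Stirling number of the second kind. -/
open Filter

namespace CatalanSat

/-- A logical connective: `and` or `or`. -/
inductive Conn : Type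
  | and : Conn
  | or : Conn

/-- An and/or tree: a binary plane tree with internal nodes labelled by a
connective and leaves labelled by a literal `(v, b)`: variable `v`, positive
if `b = true`, negated if `b = false`. -/
inductive AOTree : Type
  | leaf (v : ℕ) (b : Bool) : AOTree
  | node (c : Conn) (l r : AOTree) : AOTree

namespace AOTree

/-- The list of leaf labels (variable index, polarity), from left to right. -/
def leaves : AOTree → List (ℕ × Bool)
  | .leaf v b => [(v, b)]
  | .node _ l r => leaves l ++ leaves r

/-- The size of an and/or tree is its number of leaves. -/
def size (t : AOTree) : ℕ := t.leaves.length

/-- The number of distinct variables appearing as leaf labels. -/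
def varCount (t : AOTree) : ℕ := (t.leaves.map Prod.fst).toFinset.card

/-- The Boolean function computed by an and/or tree. -/
def eval : AOTree → (ℕ → Bool) → Bool
  | .leaf v b, x => if b then x v else !(x v)
  | .node .and l r, x => eval l x && eval r x
  | .node .or l r, x => eval l x || eval r x

end AOTree

/-- A tree-structure: a binary plane tree with internal nodes labelled by a
connective and unlabelled leaves. -/
inductive Shape : Type
  | leaf : Shape
  | node (c : Conn) (l r : Shape) : Shape

/-- The size of a tree-structure is its number of leaves. -/
def Shape.size : Shape → ℕ
  | .leaf => 1
  | .node _ l r => Shape.size l + Shape.size r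

/-- The tree-structure of an and/or tree (forget the leaf labels). -/
def AOTree.shape : AOTree → Shape
  | .leaf _ _ => .leaf
  | .node c l r => .node c l.shape r.shape

/-- The label of the `i`-th leaf (junk default when out of range). -/
def lv (t : AOTree) (i : ℕ) : ℕ × Bool := t.leaves.getD i (0, true)

/-- Two and/or trees are equivalent when they have the same tree-structure,
two leaves are labelled by the same variable in one iff they are in the other,
and two leaves are labelled by the same literal in one iff they are in the other. -/
def TreeEquiv (A B : AOTree) : Prop :=
  A.shape = B.shape ∧
  ∀ i j : ℕ, i < A.leaves.length → j < A.leaves.length →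
    (((lv A i).1 = (lv A j).1) ↔ ((lv B i).1 = (lv B j).1)) ∧
    ((lv A i = lv A j) ↔ (lv B i = lv B j))

/-- The equivalence relation on Boolean functions induced by equivalence of trees. -/
def FunEquiv (f g : (ℕ → Bool) → Bool) : Prop :=
  ∃ A B : AOTree, TreeEquiv A B ∧ A.eval = f ∧ B.eval = g

/-- The number of equivalence classes of and/or trees satisfying a property
(the property being assumed invariant under equivalence). -/
noncomputable def classCount (P : AOTree → Prop) : ℕ :=
  Nat.card (Quot (fun A B : {t : AOTree // P t} => TreeEquiv A.1 B.1))

/-- `Tcount n K`: number of equivalence classes of and/or trees of size `n`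
using at most `K` distinct variables. -/
noncomputable def Tcount (n K : ℕ) : ℕ := classCount fun t => t.size = n ∧ t.varCount ≤ K

/-- Number of such classes computing a function of the class `⟨f⟩`. -/
noncomputable def TcountClass (n K : ℕ) (f : (ℕ → Bool) → Bool) : ℕ :=
  classCount fun t => t.size = n ∧ t.varCount ≤ K ∧ FunEquiv t.eval f

/-- `P_n⟨f⟩`: the probability that a uniform equivalence class of trees of size
`n` (at most `K` variables) computes a function of `⟨f⟩`. -/
noncomputable def Pclass (n K : ℕ) (f : (ℕ → Bool) → Bool) : ℝ :=
  (TcountClass n K f : ℝ) / (Tcount n K : ℝ)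

/-- Number of classes of size `n`, at most `K` variables, computing exactly `f`. -/
noncomputable def TcountEval (n K : ℕ) (f : (ℕ → Bool) → Bool) : ℕ :=
  classCount fun t => t.size = n ∧ t.varCount ≤ K ∧ t.eval = f

/-- Stirling numbers of the second kind. -/
def stirling : ℕ → ℕ → ℕ
  | 0, 0 => 1
  | 0, _ + 1 => 0
  | _ + 1, 0 => 0
  | n + 1, k + 1 => (k + 1) * stirling n (k + 1) + stirling n k

/-- `B n k = Σ_{p=1}^{k} S(n,p)·2^{−p}`. -/
noncomputable def B (n k : ℕ) : ℝ :=
  ∑ p ∈ Finset.Icc 1 k, (stirling n p : ℝ) / 2 ^ p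

/-- `a n p = p^n/(p!·2^p)`. -/
noncomputable def a (n p : ℕ) : ℝ :=
  (p : ℝ) ^ n / ((Nat.factorial p : ℝ) * 2 ^ p)

/-- `rat_n = B_{n−1,k_n}/B_{n,k_n}`. -/
noncomputable def rat (k : ℕ → ℕ) (n : ℕ) : ℝ := B (n - 1) (k n) / B n (k n)

/-- The complexity `L(f)`: minimal size of an and/or tree computing `f`. -/
noncomputable def complexity (f : (ℕ → Bool) → Bool) : ℕ :=
  sInf {m | ∃ t : AOTree, t.size = m ∧ t.eval = f}

/-- The variable `x_i` is essential for `f`. -/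
def Essential (i : ℕ) (f : (ℕ → Bool) → Bool) : Prop :=
  ∃ x : ℕ → Bool, f (Function.update x i false) ≠ f (Function.update x i true)

/-- `E(f)`: the number of essential variables of `f`. -/
noncomputable def essCount (f : (ℕ → Bool) → Bool) : ℕ :=
  Nat.card {i : ℕ // Essential i f}

/-- The multiplicity `R⟨f⟩ = L⟨f⟩ − E⟨f⟩`. -/
noncomputable def mult (f : (ℕ → Bool) → Bool) : ℕ := complexity f - essCount f

/-- `M` is, for each `n ≥ 1`, an index of `{1,…,n}` maximizing `p ↦ p^n/(p!·2^p)`. -/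
def IsArgmax (M : ℕ → ℕ) : Prop :=
  ∀ n, 1 ≤ n → M n ∈ Finset.Icc 1 n ∧ ∀ p ∈ Finset.Icc 1 n, a n p ≤ a n (M n)

/-- There is a leaf labelled by the given literal linked to the root by
`∨`-labelled internal nodes only. -/
def orLeaf : AOTree → ℕ × Bool → Prop
  | .leaf v b, l => (v, b) = l
  | .node .or A B, l => orLeaf A l ∨ orLeaf B l
  | .node .and _ _, _ => False

/-- There is a leaf labelled by the given literal linked to the root by
`∧`-labelled internal nodes only. -/
def andLeaf : AOTree → ℕ × Bool → Prop
  | .leaf v b, l => (v, b) = l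
  | .node .and A B, l => andLeaf A l ∨ andLeaf B l
  | .node .or _ _, _ => False

/-- A simple tautology: two leaves labelled by a variable and its negation,
both linked to the root through `∨`-connectives only. -/
def IsSimpleTautology (t : AOTree) : Prop :=
  ∃ v b, orLeaf t (v, b) ∧ orLeaf t (v, !b)

/-- A simple contradiction: the dual notion. -/
def IsSimpleContradiction (t : AOTree) : Prop :=
  ∃ v b, andLeaf t (v, b) ∧ andLeaf t (v, !b)

/-- A tautology: a tree computing the constant function `true`. -/
def IsTautology (t : AOTree) : Prop := ∀ x : ℕ → Bool, t.eval x = true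

/-- A simple-x of type T: one subtree of the root is a single leaf, the other
is a simple tautology if the root is `∧`, a simple contradiction if it is `∨`. -/
def IsSimpleXT (t : AOTree) : Prop :=
  (∃ v b s, (t = .node .and (.leaf v b) s ∨ t = .node .and s (.leaf v b)) ∧
    IsSimpleTautology s) ∨
  (∃ v b s, (t = .node .or (.leaf v b) s ∨ t = .node .or s (.leaf v b)) ∧
    IsSimpleContradiction s)

/-- A simple-x of type X: one subtree of the root is a single leaf `ℓ`, the root
is `∧` (resp. `∨`), and the other subtree has a leaf labelled by the literal of
`ℓ` linked to its root by `∨`-only (resp. `∧`-only) internal nodes. -/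
def IsSimpleXX (t : AOTree) : Prop :=
  (∃ v b s, (t = .node .and (.leaf v b) s ∨ t = .node .and s (.leaf v b)) ∧
    orLeaf s (v, b)) ∨
  (∃ v b s, (t = .node .or (.leaf v b) s ∨ t = .node .or s (.leaf v b)) ∧
    andLeaf s (v, b))

/-! ### Trees as tree-structures together with their lists of leaf labels -/

section Fill

/-- The and/or tree with tree-structure `s` and leaf labels `L`, read from left to right. -/
def Shape.fill : Shape → List (ℕ × Bool) → AOTree
  | .leaf, L => .leaf (L.headD (0, true)).1 (L.headD (0, true)).2
  | .node c l r, L => .node c (l.fill (L.take l.size)) (r.fill (L.drop l.size))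

theorem Shape.shape_fill (s : Shape) (L : List (ℕ × Bool)) : (s.fill L).shape = s := by
  induction s generalizing L with
  | leaf => rfl
  | node c l r ihl ihr => simp [Shape.fill, AOTree.shape, ihl, ihr]

theorem Shape.leaves_fill (s : Shape) (L : List (ℕ × Bool)) (h : L.length = s.size) :
    (s.fill L).leaves = L := by
  induction s generalizing L with
  | leaf =>
    obtain ⟨x, rfl⟩ := List.length_eq_one_iff.1 h
    rfl
  | node c l r ihl ihr =>
    simp only [Shape.size] at h
    rw [Shape.fill, AOTree.leaves, ihl _ (by simp; omega), ihr _ (by simp; omega),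
      List.take_append_drop]

theorem AOTree.size_shape (t : AOTree) : t.shape.size = t.leaves.length := by
  induction t with
  | leaf => rfl
  | node c l r ihl ihr => simp [AOTree.shape, Shape.size, AOTree.leaves, ihl, ihr]

end Fill

/-! ### Equivalence of trees -/

section Equivalence

/-- All pairs of positions of a list of pairs of literals carry the same variable, resp. the same
literal, on the left iff they do on the right. -/
def Compatible (Z : List ((ℕ × Bool) × (ℕ × Bool))) : Prop :=
  ∀ z ∈ Z, ∀ w ∈ Z, (z.1.1 = w.1.1 ↔ z.2.1 = w.2.1) ∧ (z.1 = w.1 ↔ z.2 = w.2)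

theorem length_leaves_eq_of_shape_eq {A B : AOTree} (h : A.shape = B.shape) :
    A.leaves.length = B.leaves.length := by
  rw [← A.size_shape, h, B.size_shape]

theorem treeEquiv_iff (A B : AOTree) :
    TreeEquiv A B ↔ A.shape = B.shape ∧ Compatible (A.leaves.zip B.leaves) := by
  refine and_congr_right fun h => ?_
  have hlen := length_leaves_eq_of_shape_eq h
  have key : ∀ i (hi : i < A.leaves.length), ((A.leaves.zip B.leaves)[i]'(by simp; omega)) =
      (lv A i, lv B i) := by
    intro i hi
    simp [lv, List.getElem?_eq_getElem hi, List.getElem?_eq_getElem (hlen ▸ hi)]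
  constructor
  · intro H z hz w hw
    obtain ⟨i, hi, rfl⟩ := List.mem_iff_getElem.1 hz
    obtain ⟨j, hj, rfl⟩ := List.mem_iff_getElem.1 hw
    have hi' : i < A.leaves.length := by simp at hi; omega
    have hj' : j < A.leaves.length := by simp at hj; omega
    rw [key i hi', key j hj']
    exact H i j hi' hj'
  · intro H i j hi hj
    have := H _ (List.getElem_mem (n := i) (by simp; omega)) _
      (List.getElem_mem (n := j) (by simp; omega))
    rwa [key i hi, key j hj] at this

theorem treeEquiv_equivalence : Equivalence TreeEquiv where
  refl _ := ⟨rfl, fun _ _ _ _ => ⟨Iff.rfl, Iff.rfl⟩⟩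
  symm {A B} h := by
    have hlen := length_leaves_eq_of_shape_eq h.1
    refine ⟨h.1.symm, fun i j hi hj => ?_⟩
    obtain ⟨h₁, h₂⟩ := h.2 i j (hlen ▸ hi) (hlen ▸ hj)
    exact ⟨h₁.symm, h₂.symm⟩
  trans {A B C} h h' := by
    have hlen := length_leaves_eq_of_shape_eq h.1
    refine ⟨h.1.trans h'.1, fun i j hi hj => ?_⟩
    obtain ⟨h₁, h₂⟩ := h.2 i j hi hj
    obtain ⟨h₃, h₄⟩ := h'.2 i j (hlen ▸ hi) (hlen ▸ hj)
    exact ⟨h₁.trans h₃, h₂.trans h₄⟩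

theorem card_image_eq_card_image {α β γ : Type*} [DecidableEq β] [DecidableEq γ]
    (s : Finset α) (f : α → β) (g : α → γ)
    (h : ∀ x ∈ s, ∀ y ∈ s, f x = f y ↔ g x = g y) :
    (s.image f).card = (s.image g).card := by
  have hf : (s.image fun x => (f x, g x)).image Prod.fst = s.image f := by
    rw [Finset.image_image]; rfl
  have hg : (s.image fun x => (f x, g x)).image Prod.snd = s.image g := by
    rw [Finset.image_image]; rfl
  rw [← hf, ← hg, Finset.card_image_of_injOn (f := Prod.fst),
    Finset.card_image_of_injOn (f := Prod.snd)]
  all_goals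
    intro u hu v hv huv
    obtain ⟨x, hx, rfl⟩ := Finset.mem_image.1 (Finset.mem_coe.1 hu)
    obtain ⟨y, hy, rfl⟩ := Finset.mem_image.1 (Finset.mem_coe.1 hv)
    have := h x hx y hy
    simp_all

theorem TreeEquiv.varCount_eq {A B : AOTree} (h : TreeEquiv A B) : A.varCount = B.varCount := by
  have hlen := length_leaves_eq_of_shape_eq h.1
  have H := ((treeEquiv_iff A B).1 h).2
  have hA : (A.leaves.map Prod.fst).toFinset =
      (A.leaves.zip B.leaves).toFinset.image fun z => z.1.1 := by
    conv_lhs => rw [← List.map_fst_zip hlen.le]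
    ext
    simp
  have hB : (B.leaves.map Prod.fst).toFinset =
      (A.leaves.zip B.leaves).toFinset.image fun z => z.2.1 := by
    conv_lhs => rw [← List.map_snd_zip hlen.ge]
    ext
    simp
  rw [AOTree.varCount, AOTree.varCount, hA, hB]
  exact card_image_eq_card_image _ _ _ fun x hx y hy =>
    (H x (List.mem_toFinset.1 hx) y (List.mem_toFinset.1 hy)).1

end Equivalence

/-! ### Canonical labellings -/

section Canonical

/-- The canonical labellings of length `n` with exactly `p` variables: reading from the right, the
variables appear for the first time in the order `0, 1, …, p - 1`, each one as a positive
literal. -/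
def canonical : ℕ → ℕ → Finset (List (ℕ × Bool))
  | 0, 0 => {[]}
  | 0, _ + 1 => ∅
  | _ + 1, 0 => ∅
  | n + 1, p + 1 =>
    ((Finset.range (p + 1) ×ˢ Finset.univ) ×ˢ canonical n (p + 1)).image (fun x => x.1 :: x.2) ∪
      (canonical n p).image (fun L => (p, true) :: L)

theorem nil_mem_canonical {p : ℕ} : [] ∈ canonical 0 p ↔ p = 0 := by
  cases p <;> simp [canonical]

theorem cons_mem_canonical {n p : ℕ} {x : ℕ × Bool} {L : List (ℕ × Bool)} :
    x :: L ∈ canonical (n + 1) p ↔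
      (x.1 < p ∧ L ∈ canonical n p) ∨
        ∃ q, p = q + 1 ∧ x = (q, true) ∧ L ∈ canonical n q := by
  cases p with
  | zero => simp [canonical]
  | succ p =>
    simp only [canonical, Finset.mem_union, Finset.mem_image, Finset.mem_product, Finset.mem_range,
      Finset.mem_univ, and_true, List.cons.injEq]
    constructor
    · rintro (⟨⟨x, L⟩, h, rfl, rfl⟩ | ⟨L, h, rfl, rfl⟩)
      exacts [Or.inl h, Or.inr ⟨p, rfl, rfl, h⟩]
    · rintro (h | ⟨q, hq, rfl, h⟩)
      · exact Or.inl ⟨(x, L), h, rfl, rfl⟩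
      · obtain rfl := Nat.succ.inj hq
        exact Or.inr ⟨L, h, rfl, rfl⟩

theorem length_of_mem_canonical {n p : ℕ} {L : List (ℕ × Bool)} (h : L ∈ canonical n p) :
    L.length = n := by
  induction n generalizing p L with
  | zero => cases p <;> simp_all [canonical]
  | succ n ih =>
    cases p with
    | zero => simp [canonical] at h
    | succ p =>
      simp only [canonical, Finset.mem_union, Finset.mem_image, Finset.mem_product] at h
      rcases h with ⟨x, ⟨-, hx⟩, rfl⟩ | ⟨M, hM, rfl⟩
      · simp [ih hx]
      · simp [ih hM]

theorem exists_mem_iff_of_mem_canonical {n p : ℕ} {L : List (ℕ × Bool)} (h : L ∈ canonical n p)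
    (v : ℕ) : (∃ b, (v, b) ∈ L) ↔ v < p := by
  induction L generalizing n p with
  | nil =>
    obtain rfl : 0 = n := length_of_mem_canonical h
    simp [nil_mem_canonical.1 h]
  | cons x L ih =>
    obtain rfl : L.length + 1 = n := length_of_mem_canonical h
    have hx : (∃ b, (v, b) ∈ x :: L) ↔ v = x.1 ∨ ∃ b, (v, b) ∈ L := by
      simp [Prod.ext_iff, exists_or]
    rw [hx]
    rcases cons_mem_canonical.1 h with ⟨hp, hL⟩ | ⟨q, rfl, rfl, hL⟩
    · rw [ih hL]; omega
    · rw [ih hL]; simp only; omega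

theorem card_vars_of_mem_canonical {n p : ℕ} {L : List (ℕ × Bool)} (h : L ∈ canonical n p) :
    (L.map Prod.fst).toFinset.card = p := by
  have : (L.map Prod.fst).toFinset = Finset.range p := by
    ext v
    rw [Finset.mem_range, ← exists_mem_iff_of_mem_canonical h]
    simp
  rw [this, Finset.card_range]

theorem stirling_eq_zero_of_lt {n p : ℕ} (h : n < p) : stirling n p = 0 := by
  induction n generalizing p with
  | zero => cases p <;> simp_all [stirling]
  | succ n ih =>
    cases p with
    | zero => omega
    | succ p => simp [stirling, ih (show n < p + 1 by omega), ih (show n < p by omega)]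

theorem card_canonical {n p : ℕ} : (canonical n p).card = stirling n p * 2 ^ (n - p) := by
  induction n generalizing p with
  | zero => cases p <;> simp [canonical, stirling]
  | succ n ih =>
    cases p with
    | zero => simp [canonical, stirling]
    | succ p =>
      have hdisj : Disjoint
          (((Finset.range (p + 1) ×ˢ (Finset.univ : Finset Bool)) ×ˢ canonical n (p + 1)).image
            (fun x => x.1 :: x.2))
          ((canonical n p).image (fun L => (p, true) :: L)) := by
        simp only [Finset.disjoint_left, Finset.mem_image, Finset.mem_product]
        rintro _ ⟨⟨x, L⟩, ⟨-, hL⟩, rfl⟩ ⟨M, hM, hLM⟩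
        obtain rfl : M = L := (List.cons.inj hLM).2
        have := (card_vars_of_mem_canonical hL).symm.trans (card_vars_of_mem_canonical hM)
        omega
      rw [canonical, Finset.card_union_of_disjoint hdisj, Finset.card_image_of_injective,
        Finset.card_image_of_injective, Finset.card_product, Finset.card_product, ih, ih,
        Finset.card_range, Finset.card_univ, Fintype.card_bool, stirling, Nat.succ_sub_succ]
      · rcases lt_or_ge n (p + 1) with hn | hn
        · simp [stirling_eq_zero_of_lt hn]
        · obtain ⟨d, rfl⟩ := Nat.exists_eq_add_of_le hn
          rw [show p + 1 + d - p = d + 1 by omega, show p + 1 + d - (p + 1) = d by omega]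
          ring
      · exact fun L M h => (List.cons.inj h).2
      · exact fun x y h => Prod.ext (List.cons.inj h).1 (List.cons.inj h).2

theorem Compatible.of_cons {z : (ℕ × Bool) × (ℕ × Bool)} {Z : List ((ℕ × Bool) × (ℕ × Bool))}
    (h : Compatible (z :: Z)) : Compatible Z :=
  fun x hx y hy => h x (List.mem_cons_of_mem _ hx) y (List.mem_cons_of_mem _ hy)

theorem Compatible.cons {z : (ℕ × Bool) × (ℕ × Bool)} {Z : List ((ℕ × Bool) × (ℕ × Bool))}
    (h : Compatible Z)
    (hz : ∀ w ∈ Z, (z.1.1 = w.1.1 ↔ z.2.1 = w.2.1) ∧ (z.1 = w.1 ↔ z.2 = w.2)) :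
    Compatible (z :: Z) := by
  intro x hx y hy
  rcases List.mem_cons.1 hx with rfl | hx' <;> rcases List.mem_cons.1 hy with rfl | hy'
  · simp
  · exact hz y hy'
  · rw [eq_comm, eq_comm (a := x.2.1), eq_comm (a := x.1), eq_comm (a := x.2)]
    exact hz x hx'
  · exact h x hx' y hy'

theorem exists_canonical_compatible (L : List (ℕ × Bool)) :
    ∃ p, ∃ M ∈ canonical L.length p, Compatible (L.zip M) := by
  induction L with
  | nil => exact ⟨0, [], by simp [canonical], by simp [Compatible]⟩
  | cons x L ih =>
    obtain ⟨p, M, hM, h⟩ := ih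
    have mem_right {w : (ℕ × Bool) × (ℕ × Bool)} (hw : w ∈ L.zip M) : w.2.1 < p :=
      (exists_mem_iff_of_mem_canonical hM _).1 ⟨w.2.2, (List.of_mem_zip (b := w.2) hw).2⟩
    by_cases hx : ∃ z ∈ L.zip M, x.1 = z.1.1
    · obtain ⟨z, hz, hxz⟩ := hx
      refine ⟨p, (z.2.1, z.2.2 ^^ (x.2 ^^ z.1.2)) :: M,
        cons_mem_canonical.2 (Or.inl ⟨mem_right hz, hM⟩), h.cons fun w hw => ?_⟩
      obtain ⟨⟨a, b⟩, c, d⟩ := z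
      obtain ⟨⟨a', b'⟩, c', d'⟩ := w
      obtain ⟨v, e⟩ := x
      have := h _ hz _ hw
      simp only [Prod.mk.injEq] at this hxz ⊢
      subst hxz
      refine ⟨this.1, ?_⟩
      by_cases hv : v = a'
      · have hc := this.1.1 hv
        simp only [hv, hc, true_and] at this ⊢
        revert this
        cases b <;> cases d <;> cases b' <;> cases d' <;> cases e <;> simp
      · have hc := mt this.1.2 hv
        simp [hv, hc]
    · push Not at hx
      refine ⟨p + 1, (p, true) :: M, cons_mem_canonical.2 (Or.inr ⟨p, rfl, rfl, hM⟩),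
        h.cons fun w hw => ?_⟩
      have h₁ := hx w hw
      have h₂ := (mem_right hw).ne'
      exact ⟨iff_of_false h₁ h₂, iff_of_false (fun e => h₁ (congrArg _ e))
        fun e => h₂ (congrArg Prod.fst e)⟩

theorem mem_zip_self {α : Type*} {x : α} {L : List α} (h : x ∈ L) : (x, x) ∈ L.zip L := by
  obtain ⟨i, hi, rfl⟩ := List.mem_iff_getElem.1 h
  exact List.mem_iff_getElem.2 ⟨i, by simpa using hi, by simp⟩

theorem eq_of_compatible_of_mem_canonical {n p q : ℕ} {L M : List (ℕ × Bool)}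
    (hL : L ∈ canonical n p) (hM : M ∈ canonical n q) (h : Compatible (L.zip M)) : L = M := by
  induction L generalizing n p q M with
  | nil =>
    obtain rfl : 0 = n := length_of_mem_canonical hL
    exact (List.length_eq_zero_iff.1 (length_of_mem_canonical hM)).symm
  | cons x L ih =>
    obtain rfl : L.length + 1 = n := length_of_mem_canonical hL
    obtain _ | ⟨y, M⟩ := M
    · simpa using length_of_mem_canonical hM
    have old_iff {x : ℕ × Bool} {L : List (ℕ × Bool)} {p : ℕ}
        (hxL : x :: L ∈ canonical (L.length + 1) p) :
        ∃ q, L ∈ canonical L.length q ∧ (x.1 < q ∨ x = (q, true)) := by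
      rcases cons_mem_canonical.1 hxL with ⟨h₁, h₂⟩ | ⟨q, -, rfl, h₂⟩
      exacts [⟨p, h₂, Or.inl h₁⟩, ⟨q, h₂, Or.inr rfl⟩]
    have hlen : M.length + 1 = L.length + 1 := length_of_mem_canonical hM
    rw [← hlen] at hM
    obtain ⟨p', hL', hx⟩ := old_iff hL
    obtain ⟨q', hM', hy⟩ := old_iff hM
    rw [Nat.succ.inj hlen] at hM'
    rw [List.zip_cons_cons] at h
    obtain rfl := ih hL' hM' h.of_cons
    obtain rfl : p' = q' :=
      (card_vars_of_mem_canonical hL').symm.trans (card_vars_of_mem_canonical hM')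
    have H : ∀ w ∈ L, (x.1 = w.1 ↔ y.1 = w.1) ∧ (x = w ↔ y = w) := fun w hw =>
      h _ List.mem_cons_self _ (List.mem_cons_of_mem _ (mem_zip_self hw))
    have occurs := exists_mem_iff_of_mem_canonical hL'
    congr 1
    obtain ⟨v, b⟩ := x
    obtain ⟨w, c⟩ := y
    by_cases hv : v < p'
    · obtain ⟨d, hd⟩ := (occurs v).2 hv
      obtain ⟨h₁, h₂⟩ := H _ hd
      obtain rfl : w = v := h₁.1 rfl
      simp only [Prod.mk.injEq, true_and] at h₂ ⊢
      revert h₂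
      cases b <;> cases c <;> cases d <;> simp
    · have hw : ¬ w < p' := fun hw => by
        obtain ⟨d, hd⟩ := (occurs w).2 hw
        obtain rfl : v = w := (H _ hd).1.2 rfl
        exact hv hw
      rw [hx.resolve_left hv, hy.resolve_left hw]

end Canonical

/-! ### Counting tree-structures -/

section Shapes

open Finset hiding antidiagonal mem_antidiagonal
open Finset.HasAntidiagonal
open Finset.HasAntidiagonal.antidiagonal (fst_le snd_le)

noncomputable instance : DecidableEq Conn := Classical.decEq _

noncomputable instance : DecidableEq Shape := Classical.decEq _

/-- The tree-structures with `n` internal nodes. -/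
noncomputable def shapes : ℕ → Finset Shape
  | 0 => {.leaf}
  | n + 1 =>
    (antidiagonal n).attach.biUnion fun ij =>
      (({Conn.and, Conn.or} : Finset Conn) ×ˢ shapes ij.1.1 ×ˢ shapes ij.1.2).image
        fun x => .node x.1 x.2.1 x.2.2
  decreasing_by
    · simp_wf; have := fst_le ij.2; lia
    · simp_wf; have := snd_le ij.2; lia

theorem shapes_succ (n : ℕ) :
    shapes (n + 1) = (antidiagonal n).biUnion fun ij =>
      (({Conn.and, Conn.or} : Finset Conn) ×ˢ shapes ij.1 ×ˢ shapes ij.2).image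
        fun x => .node x.1 x.2.1 x.2.2 := by
  rw [shapes]
  ext
  simp

theorem Shape.size_pos (s : Shape) : 0 < s.size := by
  induction s with
  | leaf => exact Nat.one_pos
  | node c l r ihl ihr => exact Nat.add_pos_left ihl _

theorem mem_shapes {s : Shape} {n : ℕ} : s ∈ shapes n ↔ s.size = n + 1 := by
  induction s generalizing n with
  | leaf => cases n <;> simp [shapes, shapes_succ, Shape.size]
  | node c l r ihl ihr =>
    have hl := l.size_pos
    have hr := r.size_pos
    cases n with
    | zero => simp [shapes, Shape.size]; omega
    | succ n =>
      have hc : c = .and ∨ c = .or := by cases c <;> simp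
      simp only [shapes_succ, mem_biUnion, mem_antidiagonal, mem_image, mem_product, mem_insert,
        mem_singleton, Shape.node.injEq, Prod.exists, Shape.size]
      constructor
      · rintro ⟨i, j, hij, c', l', r', ⟨-, hl', hr'⟩, rfl, rfl, rfl⟩
        rw [ihl] at hl'
        rw [ihr] at hr'
        omega
      · intro h
        exact ⟨l.size - 1, r.size - 1, by omega, c, l, r,
          ⟨hc, ihl.2 (by omega), ihr.2 (by omega)⟩, rfl, rfl, rfl⟩

theorem card_shapes (n : ℕ) : #(shapes n) = 2 ^ n * catalan n := by
  induction n using Nat.case_strong_induction_on with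
  | hz => simp [shapes]
  | hi n ih =>
    rw [shapes_succ, card_biUnion, catalan_succ', mul_sum]
    · refine sum_congr rfl fun ⟨i, j⟩ hij => ?_
      rw [card_image_of_injective, card_product, card_product,
        ih _ (fst_le hij), ih _ (snd_le hij), card_pair (by simp),
        ← mem_antidiagonal.1 hij]
      · ring
      · rintro ⟨c, l, r⟩ ⟨c', l', r'⟩ h
        simpa using h
    · rintro ⟨i, j⟩ - ⟨i', j'⟩ - hne
      rw [Function.onFun, disjoint_left]
      intro s hs hs'
      simp only [mem_image, mem_product, mem_shapes] at hs hs'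
      obtain ⟨⟨c, l, r⟩, ⟨-, hl, hr⟩, rfl⟩ := hs
      obtain ⟨⟨c', l', r'⟩, ⟨-, hl', hr'⟩, h⟩ := hs'
      obtain ⟨-, rfl, rfl⟩ := Shape.node.inj h
      apply hne
      simp only [Prod.mk.injEq]
      constructor <;> simp only at hl hl' hr hr' <;> omega

end Shapes

/-! ### Counting equivalence classes -/

/-- The canonical labellings of length `n` with at least one and at most `K` variables. -/
def labellings (n K : ℕ) : Finset (List (ℕ × Bool)) := (Finset.Icc 1 K).biUnion (canonical n)

theorem card_labellings (n K : ℕ) :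
    (labellings n K).card = ∑ p ∈ Finset.Icc 1 K, stirling n p * 2 ^ (n - p) := by
  rw [labellings, Finset.card_biUnion]
  · exact Finset.sum_congr rfl fun _ _ => card_canonical
  · intro p _ q _ hpq
    rw [Function.onFun, Finset.disjoint_left]
    exact fun L hp hq =>
      hpq ((card_vars_of_mem_canonical hp).symm.trans (card_vars_of_mem_canonical hq))

theorem Tcount_succ (m K : ℕ) :
    Tcount (m + 1) K = (shapes m).card * (labellings (m + 1) K).card := by
  have length_eq (x : shapes m × labellings (m + 1) K) : x.2.1.length = x.1.1.size := by
    obtain ⟨p, -, hp⟩ := Finset.mem_biUnion.1 x.2.2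
    rw [length_of_mem_canonical hp, mem_shapes.1 x.1.2]
  let toTree (x : shapes m × labellings (m + 1) K) :
      {t : AOTree // t.size = m + 1 ∧ t.varCount ≤ K} :=
    ⟨x.1.1.fill x.2.1, by
      obtain ⟨p, hpK, hp⟩ := Finset.mem_biUnion.1 x.2.2
      rw [AOTree.size, AOTree.varCount, Shape.leaves_fill _ _ (length_eq x),
        card_vars_of_mem_canonical hp, length_of_mem_canonical hp]
      exact ⟨rfl, (Finset.mem_Icc.1 hpK).2⟩⟩
  let toClass (x : shapes m × labellings (m + 1) K) :
      Quot fun A B : {t : AOTree // t.size = m + 1 ∧ t.varCount ≤ K} => TreeEquiv A.1 B.1 :=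
    Quot.mk _ (toTree x)
  have hbij : Function.Bijective toClass := by
    constructor
    · intro x y hxy
      have h : TreeEquiv (toTree x).1 (toTree y).1 :=
        (treeEquiv_equivalence.comap Subtype.val).eqvGen_iff.1 (Quot.eqvGen_exact hxy)
      rw [treeEquiv_iff] at h
      simp only [toTree, Shape.shape_fill, Shape.leaves_fill _ _ (length_eq _)] at h
      obtain ⟨p, -, hp⟩ := Finset.mem_biUnion.1 x.2.2
      obtain ⟨q, -, hq⟩ := Finset.mem_biUnion.1 y.2.2
      exact Prod.ext (Subtype.ext h.1)
        (Subtype.ext (eq_of_compatible_of_mem_canonical hp hq h.2))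
    · rintro ⟨t, ht, htK⟩
      obtain ⟨p, M, hM, h⟩ := exists_canonical_compatible t.leaves
      have hlen : M.length = t.shape.size := by rw [length_of_mem_canonical hM, t.size_shape]
      have hequiv : TreeEquiv t (t.shape.fill M) := by
        rw [treeEquiv_iff, Shape.shape_fill, Shape.leaves_fill _ _ hlen]
        exact ⟨rfl, h⟩
      rw [AOTree.size] at ht
      rw [ht] at hM
      have hpK : p ≤ K := by
        rw [hequiv.varCount_eq, AOTree.varCount, Shape.leaves_fill _ _ hlen,
          card_vars_of_mem_canonical hM] at htK
        exact htK
      have hp : 1 ≤ p := by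
        refine Nat.one_le_iff_ne_zero.2 ?_
        rintro rfl
        simp [canonical] at hM
      refine ⟨(⟨t.shape, mem_shapes.2 (by rw [t.size_shape, ht])⟩,
        ⟨M, Finset.mem_biUnion.2 ⟨p, Finset.mem_Icc.2 ⟨hp, hpK⟩, hM⟩⟩), ?_⟩
      exact Quot.sound (treeEquiv_equivalence.symm hequiv)
  rw [Tcount, classCount, ← Nat.card_congr (Equiv.ofBijective toClass hbij)]
  simp

/-- counting formula for the number `T_n` of equivalence classes of
and/or trees of size `n` using at most `k_n` distinct variables. -/
theorem stmt_0 (k : ℕ → ℕ) (hk_mono : Monotone k)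
    (hk_pos : ∀ n, 1 ≤ n → 1 ≤ k n) (hk_le : ∀ n, 1 ≤ n → k n ≤ n)
    (hk_tend : Tendsto k atTop atTop) :
    ∀ n, 1 ≤ n →
      Tcount n (k n) =
        catalan (n - 1) *
          ∑ p ∈ Finset.Icc 1 (k n), stirling n p * 2 ^ (2 * n - 1 - p) := by
  intro n hn
  obtain ⟨m, rfl⟩ := Nat.exists_eq_add_of_le' hn
  rw [Tcount_succ, card_shapes, card_labellings, Nat.add_sub_cancel, mul_comm (2 ^ m), mul_assoc,
    Finset.mul_sum]
  congr 1
  refine Finset.sum_congr rfl fun p hp => ?_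
  have hpm : p ≤ m + 1 := (Finset.mem_Icc.1 hp).2.trans (hk_le _ hn)
  rw [show 2 * (m + 1) - 1 - p = m + (m + 1 - p) by omega, pow_add]
  ring

end CatalanSat
end

section
/- Let (k_n)_{n≥1} be an increasing sequence of positive integers with k_n ≤ n for all n and k_n → ∞, and let M_n be the index maximizing p ↦ p^n/(p!·2^p) on {1,…,n}. Assume k_n ≥ M_n for all large enough n. Then B_{n,k_{n+1}}/B_{n+1,k_{n+1}} = Θ(ln n / n) as n → ∞; that is, there exist constants c, C > 0 and N such that for all n ≥ N: c·ln n/n ≤ B_{n,k_{n+1}}/B_{n+1,k_{n+1}} ≤ C·ln n/n. -/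
open Filter

namespace CatalanSat

/-- The number of surjections from an `n`-element set onto a `p`-element set. -/
def surj (n p : ℕ) : ℕ := p.factorial * stirling n p

lemma surj_succ_succ (n p : ℕ) :
    surj (n + 1) (p + 1) = (p + 1) * surj n (p + 1) + (p + 1) * surj n p := by
  simp only [surj, stirling, Nat.factorial_succ]
  ring

lemma sum_choose_mul_surj (n p : ℕ) :
    ∑ q ∈ Finset.range (p + 1), p.choose q * surj n q = p ^ n := by
  induction n with
  | zero =>
    rw [Finset.sum_range_succ']
    simp [surj, stirling]
  | succ n ih =>
    have h0 : surj (n + 1) 0 = 0 := by simp [surj, stirling]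
    have h1 : ∑ q ∈ Finset.range (p + 1), p.choose q * (q * surj n q)
        = ∑ q ∈ Finset.range p, p.choose (q + 1) * ((q + 1) * surj n (q + 1)) := by
      rw [Finset.sum_range_succ']
      simp
    have h2 : ∑ q ∈ Finset.range (p + 1), p.choose q * ((p - q) * surj n q)
        = ∑ q ∈ Finset.range p, p.choose (q + 1) * ((q + 1) * surj n q) := by
      rw [Finset.sum_range_succ]
      simp only [Nat.sub_self, zero_mul, mul_zero, add_zero]
      refine Finset.sum_congr rfl fun q _ => ?_
      rw [← mul_assoc, ← mul_assoc, Nat.choose_succ_right_eq]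
    rw [Finset.sum_range_succ', h0, mul_zero, add_zero, pow_succ, ← ih, Finset.sum_mul]
    simp only [surj_succ_succ, mul_add]
    rw [Finset.sum_add_distrib, ← h1, ← h2, ← Finset.sum_add_distrib]
    refine Finset.sum_congr rfl fun q hq => ?_
    have hq' : q + (p - q) = p := by
      have := Finset.mem_range.1 hq
      omega
    rw [← mul_add, ← add_mul, hq']
    ring

lemma surj_le_pow (n p : ℕ) : surj n p ≤ p ^ n := by
  rw [← sum_choose_mul_surj n p, Finset.sum_range_succ]
  simp

lemma pow_le_surj_add (n p : ℕ) :
    (p + 1) ^ n ≤ surj n (p + 1) + (p + 1) * p ^ n := by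
  rw [← sum_choose_mul_surj n (p + 1), Finset.sum_range_succ, ← sum_choose_mul_surj n p,
    Finset.mul_sum, Nat.choose_self, one_mul, add_comm]
  refine Nat.add_le_add_left (Finset.sum_le_sum fun q hq => ?_) _
  have hq' : 1 ≤ p + 1 - q := by
    have := Finset.mem_range.1 hq
    omega
  calc (p + 1).choose q * surj n q
      ≤ (p + 1).choose q * (p + 1 - q) * surj n q := by
        gcongr
        exact Nat.le_mul_of_pos_right _ hq'
    _ = (p + 1) * (p.choose q * surj n q) := by
        rw [← Nat.choose_mul_succ_eq]
        ring

/-- The summands of `B n k`. -/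
noncomputable def w (n p : ℕ) : ℝ := (stirling n p : ℝ) / 2 ^ p

lemma w_nonneg (n p : ℕ) : 0 ≤ w n p := by
  unfold w
  positivity

lemma w_eq (n p : ℕ) : w n p = surj n p / ((p.factorial : ℝ) * 2 ^ p) := by
  unfold w surj
  push_cast
  have : (p.factorial : ℝ) ≠ 0 := by positivity
  field_simp

lemma w_le_a (n p : ℕ) : w n p ≤ a n p := by
  rw [w_eq, a]
  gcongr
  exact_mod_cast surj_le_pow n p

lemma a_nonneg (n p : ℕ) : 0 ≤ a n p := by
  unfold a
  positivity

lemma a_succ (n p : ℕ) :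
    a n (p + 1) = ((p + 1 : ℕ) : ℝ) ^ n / ((p + 1) * 2) / ((p.factorial : ℝ) * 2 ^ p) := by
  rw [a, Nat.factorial_succ, pow_succ, div_div]
  push_cast
  congr 1
  ring

/-- At an index where `a n` has not decreased, the upper bound `w ≤ a` is sharp up to a
factor two. -/
lemma a_succ_le_two_mul_w {n p : ℕ} (h : a n p ≤ a n (p + 1)) :
    a n (p + 1) ≤ 2 * w n (p + 1) := by
  rw [a_succ, a, div_le_div_iff_of_pos_right (by positivity), le_div_iff₀ (by positivity)] at h
  have h2 : (((p + 1) ^ n : ℕ) : ℝ) ≤ ((surj n (p + 1) + (p + 1) * p ^ n : ℕ) : ℝ) := by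
    exact_mod_cast pow_le_surj_add n p
  push_cast at h h2
  rw [w_eq, a, ← mul_div_assoc]
  gcongr
  push_cast
  linarith

lemma two_mul_w_le {n p : ℕ} (h : 5 * ((p : ℝ) + 1) * (p : ℝ) ^ n ≤ ((p : ℝ) + 1) ^ n) :
    2 * w n p ≤ w n (p + 1) := by
  have h1 : (surj n p : ℝ) ≤ (p : ℝ) ^ n := by exact_mod_cast surj_le_pow n p
  have h2 : (((p + 1) ^ n : ℕ) : ℝ) ≤ ((surj n (p + 1) + (p + 1) * p ^ n : ℕ) : ℝ) := by
    exact_mod_cast pow_le_surj_add n p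
  push_cast at h2
  have h3 : 4 * ((p : ℝ) + 1) * surj n p ≤ surj n (p + 1) := by
    have := mul_le_mul_of_nonneg_left h1 (by positivity : (0 : ℝ) ≤ 4 * (p + 1))
    linarith
  rw [w_eq, w_eq, Nat.factorial_succ, pow_succ, ← mul_div_assoc,
    div_le_div_iff₀ (by positivity) (by positivity)]
  push_cast
  have := mul_le_mul_of_nonneg_right h3 (by positivity : (0 : ℝ) ≤ (p.factorial : ℝ) * 2 ^ p)
  linarith

lemma a_lt_a_succ {n p : ℕ} (hp : 1 ≤ p)
    (h : 5 * ((p : ℝ) + 1) * (p : ℝ) ^ n ≤ ((p : ℝ) + 1) ^ n) : a n p < a n (p + 1) := by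
  have hp0 : (0 : ℝ) < p := by exact_mod_cast hp
  rw [a_succ, a, div_lt_div_iff_of_pos_right (by positivity), lt_div_iff₀ (by positivity)]
  push_cast
  have : 0 < ((p : ℝ) + 1) * (p : ℝ) ^ n := by positivity
  linarith

lemma two_mul_a_succ_le {n p : ℕ} (h : ((p : ℝ) + 1) ^ n ≤ ((p : ℝ) + 1) * (p : ℝ) ^ n) :
    2 * a n (p + 1) ≤ a n p := by
  rw [a_succ, a, ← mul_div_assoc, ← mul_div_assoc,
    div_le_div_iff_of_pos_right (by positivity), div_le_iff₀ (by positivity)]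
  push_cast
  linarith

lemma exp_mul_pow_le {x : ℝ} (hx : 0 < x) (n : ℕ) :
    Real.exp (n / (x + 1)) * x ^ n ≤ (x + 1) ^ n := by
  have h : Real.exp (1 / (x + 1)) * x ≤ x + 1 := by
    have h1 := Real.add_one_le_exp (-(1 / (x + 1)))
    have h2 : -(1 / (x + 1)) + 1 = x / (x + 1) := by
      field_simp
      ring
    rw [h2, Real.exp_neg, div_le_iff₀ (by positivity)] at h1
    rw [← le_inv_mul_iff₀ (Real.exp_pos _)]
    exact h1
  calc Real.exp (n / (x + 1)) * x ^ n = (Real.exp (1 / (x + 1)) * x) ^ n := by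
        rw [mul_pow, ← Real.exp_nat_mul, mul_one_div]
    _ ≤ (x + 1) ^ n := by gcongr

lemma pow_le_exp_mul_pow {x : ℝ} (hx : 0 < x) (n : ℕ) :
    (x + 1) ^ n ≤ Real.exp (n / x) * x ^ n := by
  have h : x + 1 ≤ Real.exp (1 / x) * x := by
    have h1 := mul_le_mul_of_nonneg_right (Real.add_one_le_exp (1 / x)) hx.le
    rw [add_mul, one_mul, one_div_mul_cancel hx.ne'] at h1
    linarith
  calc (x + 1) ^ n ≤ (Real.exp (1 / x) * x) ^ n := by gcongr
    _ = Real.exp (n / x) * x ^ n := by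
        rw [mul_pow, ← Real.exp_nat_mul, mul_one_div]

lemma five_mul_pow_le {n p : ℕ} (hn : 5 ≤ n) (hp : 1 ≤ p) (hpn : p + 1 ≤ n)
    (h : 2 * Real.log n * (p + 1) ≤ n) :
    5 * ((p : ℝ) + 1) * (p : ℝ) ^ n ≤ ((p : ℝ) + 1) ^ n := by
  have hp0 : (0 : ℝ) < p := by exact_mod_cast hp
  have hn0 : (0 : ℝ) < n := by positivity
  have hn5 : (5 : ℝ) ≤ n := by exact_mod_cast hn
  have hpn' : (p : ℝ) + 1 ≤ n := by exact_mod_cast hpn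
  refine le_trans ?_ (exp_mul_pow_le hp0 n)
  gcongr
  have h1 : 2 * Real.log n ≤ n / (p + 1) := by rwa [le_div_iff₀ (by positivity)]
  have h2 : (n : ℝ) * n ≤ Real.exp (n / (p + 1)) := by
    refine le_trans (le_of_eq ?_) (Real.exp_le_exp.2 h1)
    rw [two_mul, Real.exp_add, Real.exp_log hn0]
  nlinarith

lemma pow_succ_le {n p : ℕ} (hn : 1 ≤ n) (hp : 1 ≤ p) (h : 2 * (n : ℝ) ≤ Real.log n * p) :
    ((p : ℝ) + 1) ^ n ≤ ((p : ℝ) + 1) * (p : ℝ) ^ n := by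
  have hp0 : (0 : ℝ) < p := by exact_mod_cast hp
  have hn0 : (0 : ℝ) < n := by exact_mod_cast hn
  refine (pow_le_exp_mul_pow hp0 n).trans ?_
  gcongr
  have h1 : n / (p : ℝ) ≤ Real.log n / 2 := by
    rw [div_le_div_iff₀ hp0 (by norm_num)]
    linarith
  have h2 : Real.exp (Real.log n / 2) = √n := by
    rw [← Real.log_sqrt hn0.le, Real.exp_log (Real.sqrt_pos.2 hn0)]
  have h3 : √(n : ℝ) ≤ p := by
    have h4 : Real.log n ≤ 2 * √n := by
      have := Real.log_le_self (Real.sqrt_nonneg (n : ℝ))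
      rw [Real.log_sqrt hn0.le] at this
      linarith
    have h5 : 0 < √(n : ℝ) := Real.sqrt_pos.2 hn0
    have h6 := Real.mul_self_sqrt hn0.le
    have h7 := mul_le_mul_of_nonneg_right h4 hp0.le
    nlinarith
  linarith [Real.exp_le_exp.2 h1]

lemma B_succ (n k : ℕ) :
    B (n + 1) (k + 1)
      = ∑ p ∈ Finset.range (k + 2), (p : ℝ) * w n p + (∑ p ∈ Finset.range (k + 1), w n p) / 2 := by
  have h : B (n + 1) (k + 1) = ∑ p ∈ Finset.range (k + 1), w (n + 1) (p + 1) := by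
    rw [B, Finset.range_eq_Ico, Finset.sum_Ico_add' (fun p => w (n + 1) p) 0 (k + 1) 1]
    rfl
  rw [h, Finset.sum_range_succ' _ (k + 1), Finset.sum_div]
  simp only [Nat.cast_zero, zero_mul, add_zero, ← Finset.sum_add_distrib]
  refine Finset.sum_congr rfl fun p _ => ?_
  simp only [w, stirling, pow_succ]
  push_cast
  field_simp

lemma B_eq {n : ℕ} (hn : 1 ≤ n) (k : ℕ) : B n k = ∑ p ∈ Finset.range (k + 1), w n p := by
  obtain ⟨n, rfl⟩ := Nat.exists_eq_add_of_le' hn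
  rw [Finset.sum_range_succ', B, Finset.range_eq_Ico,
    Finset.sum_Ico_add' (fun p => w (n + 1) p) 0 k 1]
  have h0 : w (n + 1) 0 = 0 := by simp [w, stirling]
  rw [h0, add_zero]
  rfl

/-- If `f` at least doubles at each step up to `q`, the terms of index at least `q` carry at
least half of the sum. -/
lemma mul_sum_le_of_doubling {f : ℕ → ℝ} (hf : ∀ p, 0 ≤ f p) {q k : ℕ} (hqk : q ≤ k)
    (h : ∀ p, p + 1 ≤ q → 2 * f p ≤ f (p + 1)) :
    (q : ℝ) * ∑ p ∈ Finset.range (k + 1), f p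
      ≤ 2 * ∑ p ∈ Finset.range (k + 1), (p : ℝ) * f p := by
  have h1 : ∀ m, m ≤ q → ∑ p ∈ Finset.range m, f p ≤ f m := by
    intro m
    induction m with
    | zero => simpa using hf 0
    | succ m ih =>
      intro hm
      rw [Finset.sum_range_succ]
      linarith [ih (by omega), h m hm]
  have h2 := Finset.sum_range_add_sum_Ico f (show q ≤ k + 1 by omega)
  have h3 : f q ≤ ∑ p ∈ Finset.Ico q (k + 1), f p :=
    Finset.single_le_sum (fun p _ => hf p) (Finset.mem_Ico.2 ⟨le_rfl, by omega⟩)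
  have h4 : (q : ℝ) * ∑ p ∈ Finset.Ico q (k + 1), f p
      ≤ ∑ p ∈ Finset.range (k + 1), (p : ℝ) * f p := by
    rw [Finset.mul_sum]
    calc ∑ p ∈ Finset.Ico q (k + 1), (q : ℝ) * f p
        ≤ ∑ p ∈ Finset.Ico q (k + 1), (p : ℝ) * f p := by
          refine Finset.sum_le_sum fun p hp => ?_
          have := hf p
          gcongr
          exact (Finset.mem_Ico.1 hp).1
      _ ≤ _ := by
          refine Finset.sum_le_sum_of_subset_of_nonneg (fun p hp => ?_) fun p _ _ => ?_
          · exact Finset.mem_range.2 (Finset.mem_Ico.1 hp).2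
          · exact mul_nonneg p.cast_nonneg (hf p)
  have h5 : ∑ p ∈ Finset.range (k + 1), f p ≤ 2 * ∑ p ∈ Finset.Ico q (k + 1), f p := by
    linarith [h1 q le_rfl]
  have := mul_le_mul_of_nonneg_left h5 (Nat.cast_nonneg (α := ℝ) q)
  linarith

/-- If `f` at least halves at each step from `P` on, its excess first moment over `P` is at
most `2 * f P`. -/
lemma sum_tsub_mul_le_of_halving {f : ℕ → ℝ} (hf : ∀ p, 0 ≤ f p) {P : ℕ}
    (h : ∀ p, P ≤ p → 2 * f (p + 1) ≤ f p) (m : ℕ) :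
    ∑ p ∈ Finset.range m, ((p - P : ℕ) : ℝ) * f p ≤ 2 * f P := by
  have h1 : ∀ m : ℕ, ∑ p ∈ Finset.range (P + m), ((p - P : ℕ) : ℝ) * f p
      + (2 * m + 2) * f (P + m) ≤ 2 * f P := by
    intro m
    induction m with
    | zero =>
      have : ∑ p ∈ Finset.range (P + 0), ((p - P : ℕ) : ℝ) * f p = 0 := by
        refine Finset.sum_eq_zero fun p hp => ?_
        rw [Nat.sub_eq_zero_of_le (by simpa using (Finset.mem_range.1 hp).le)]
        simp
      rw [this]
      simp
    | succ m ih =>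
      rw [← add_assoc, Finset.sum_range_succ, Nat.add_sub_cancel_left]
      have := mul_le_mul_of_nonneg_left (h (P + m) (by omega))
        (by positivity : (0 : ℝ) ≤ m + 2)
      push_cast
      linarith
  have h2 : ∑ p ∈ Finset.range m, ((p - P : ℕ) : ℝ) * f p
      ≤ ∑ p ∈ Finset.range (P + m), ((p - P : ℕ) : ℝ) * f p := by
    refine Finset.sum_le_sum_of_subset_of_nonneg
      (Finset.range_subset_range.2 (by omega)) fun p _ _ => ?_
    exact mul_nonneg (Nat.cast_nonneg _) (hf p)
  have := mul_nonneg (by positivity : (0 : ℝ) ≤ 2 * m + 2) (hf (P + m))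
  linarith [h1 m]

lemma sum_mul_w_le {n k m P : ℕ} (hmk : m ≤ k) (hm : a n m ≤ 2 * w n m) (hP : a n P ≤ a n m)
    (h : ∀ p, P ≤ p → 2 * a n (p + 1) ≤ a n p) :
    ∑ p ∈ Finset.range (k + 1), (p : ℝ) * w n p
      ≤ (P + 4) * ∑ p ∈ Finset.range (k + 1), w n p := by
  have h1 : w n m ≤ ∑ p ∈ Finset.range (k + 1), w n p :=
    Finset.single_le_sum (fun p _ => w_nonneg n p) (Finset.mem_range.2 (by omega))
  have h2 := sum_tsub_mul_le_of_halving (a_nonneg n) h (k + 1)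
  have h3 : ∑ p ∈ Finset.range (k + 1), (p : ℝ) * w n p
      ≤ ∑ p ∈ Finset.range (k + 1), (P * w n p + ((p - P : ℕ) : ℝ) * a n p) := by
    refine Finset.sum_le_sum fun p _ => ?_
    have h4 : (p : ℝ) ≤ P + (p - P : ℕ) := by
      exact_mod_cast (by omega : p ≤ P + (p - P))
    have h5 := mul_le_mul_of_nonneg_right h4 (w_nonneg n p)
    have h6 := mul_le_mul_of_nonneg_left (w_le_a n p) (Nat.cast_nonneg (α := ℝ) (p - P))
    linarith
  rw [Finset.sum_add_distrib, ← Finset.mul_sum] at h3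
  linarith

/-- if `k_n ≥ M_n` eventually, then
`B_{n,k_{n+1}}/B_{n+1,k_{n+1}} = Θ(ln n/n)`. -/
theorem stmt_10 (M : ℕ → ℕ) (hM : IsArgmax M)
    (k : ℕ → ℕ) (hk_mono : Monotone k)
    (hk_pos : ∀ n, 1 ≤ n → 1 ≤ k n) (hk_le : ∀ n, 1 ≤ n → k n ≤ n)
    (hk_tend : Tendsto k atTop atTop)
    (hkM : ∃ N, ∀ n, N ≤ n → M n ≤ k n) :
    ∃ c C : ℝ, 0 < c ∧ 0 < C ∧ ∃ N : ℕ, ∀ n, N ≤ n →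
      c * Real.log n / (n : ℝ) ≤ B n (k (n + 1)) / B (n + 1) (k (n + 1)) ∧
      B n (k (n + 1)) / B (n + 1) (k (n + 1)) ≤ C * Real.log n / (n : ℝ) := by
  obtain ⟨N, hN⟩ := hkM
  have hlog : ∀ᶠ n : ℕ in atTop, 2 ≤ Real.log n :=
    (Real.tendsto_log_atTop.comp tendsto_natCast_atTop_atTop).eventually_ge_atTop 2
  have hlog' : ∀ᶠ n : ℕ in atTop, 4 * Real.log n ≤ n := by
    have := (Real.isLittleO_log_id_atTop.comp_tendsto
      (tendsto_natCast_atTop_atTop (R := ℝ))).bound (show (0 : ℝ) < 1 / 4 by norm_num)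
    filter_upwards [this] with n hn
    simp only [Function.comp, id, Real.norm_eq_abs, Nat.abs_cast] at hn
    linarith [le_abs_self (Real.log n)]
  refine ⟨1 / 8, 8, by norm_num, by norm_num, ?_⟩
  rw [← eventually_atTop]
  filter_upwards [hlog, hlog', eventually_ge_atTop 5, eventually_ge_atTop N]
    with n hl2 hl4 hn5 hnN
  have hn0 : (0 : ℝ) < n := by positivity
  have hl0 : 0 < Real.log n := by linarith
  obtain ⟨hMmem, hMmax⟩ := hM n (by omega)
  obtain ⟨hM1, hMn⟩ := Finset.mem_Icc.1 hMmem
  have hMk : M n ≤ k (n + 1) := (hN n hnN).trans (hk_mono n.le_succ)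
  set q : ℕ := ⌊n / (2 * Real.log n)⌋₊
  set P : ℕ := ⌈2 * n / Real.log n⌉₊
  have hstep : ∀ p : ℕ, 1 ≤ p → p + 1 ≤ q → p + 1 ≤ n ∧
      5 * ((p : ℝ) + 1) * (p : ℝ) ^ n ≤ ((p : ℝ) + 1) ^ n := by
    intro p hp hpq
    have h1 : ((p + 1 : ℕ) : ℝ) ≤ n / (2 * Real.log n) :=
      (Nat.le_floor_iff (by positivity)).1 hpq
    rw [le_div_iff₀ (by positivity)] at h1
    have h2 : ((p + 1 : ℕ) : ℝ) ≤ n := by nlinarith [Nat.cast_nonneg (α := ℝ) (p + 1)]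
    have h3 : p + 1 ≤ n := by exact_mod_cast h2
    push_cast at h1
    exact ⟨h3, five_mul_pow_le hn5 hp h3 (by linarith)⟩
  have hqM : q ≤ M n := by
    by_contra! hlt
    obtain ⟨h1, h2⟩ := hstep (M n) hM1 hlt
    exact absurd (hMmax (M n + 1) (Finset.mem_Icc.2 ⟨by omega, h1⟩))
      (not_le.2 (a_lt_a_succ hM1 h2))
  have hPpos : 1 ≤ P := Nat.ceil_pos.2 (by positivity)
  have hPn : P ≤ n := by
    refine Nat.ceil_le.2 ?_
    rw [div_le_iff₀ hl0]
    nlinarith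
  have hhalf : ∀ p, P ≤ p → 2 * a n (p + 1) ≤ a n p := by
    intro p hp
    refine two_mul_a_succ_le (pow_succ_le (by omega) (by omega) ?_)
    have h1 : 2 * n / Real.log n ≤ p := Nat.ceil_le.1 hp
    rw [div_le_iff₀ hl0] at h1
    linarith
  have hMw : a n (M n) ≤ 2 * w n (M n) := by
    obtain ⟨m, hm⟩ := Nat.exists_eq_add_of_le' hM1
    rw [hm]
    refine a_succ_le_two_mul_w ?_
    rcases Nat.eq_zero_or_pos m with rfl | hm0
    · refine le_trans (le_of_eq ?_) (a_nonneg n _)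
      simp [a, show n ≠ 0 by omega]
    · rw [← hm]
      exact hMmax m (Finset.mem_Icc.2 ⟨hm0, by omega⟩)
  have hdouble : ∀ p, p + 1 ≤ q → 2 * w n p ≤ w n (p + 1) := by
    intro p hp
    rcases Nat.eq_zero_or_pos p with rfl | hp0
    · have h0 : w n 0 = 0 := by
        obtain ⟨n', rfl⟩ := Nat.exists_eq_add_of_le' (show 1 ≤ n by omega)
        simp [w, stirling]
      rw [h0, mul_zero]
      exact w_nonneg n _
    · exact two_mul_w_le (hstep p hp0 hp).2
  obtain ⟨j, hj⟩ := Nat.exists_eq_add_of_le' (hM1.trans hMk)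
  have hlow := mul_sum_le_of_doubling (w_nonneg n) (hqM.trans hMk) hdouble
  have hup := sum_mul_w_le hMk hMw (hMmax P (Finset.mem_Icc.2 ⟨hPpos, hPn⟩)) hhalf
  have hwM : 0 < w n (M n) := by
    have : 0 < a n (M n) := by
      have : (0 : ℝ) < M n := by exact_mod_cast hM1
      unfold a
      positivity
    linarith
  have hBpos : 0 < B n (k (n + 1)) := by
    rw [B_eq (by omega)]
    exact hwM.trans_le (Finset.single_le_sum (fun p _ => w_nonneg n p)
      (Finset.mem_range.2 (by omega)))
  rw [← B_eq (by omega)] at hlow hup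
  have hBs := B_succ n j
  rw [← B_eq (by omega) j, ← hj, show j + 2 = k (n + 1) + 1 by omega] at hBs
  have hBj : 0 ≤ B n j := by
    rw [B_eq (by omega)]
    exact Finset.sum_nonneg fun p _ => w_nonneg n p
  have hBjk : B n j ≤ B n (k (n + 1)) := by
    rw [B_eq (by omega), B_eq (by omega)]
    exact Finset.sum_le_sum_of_subset_of_nonneg
      (Finset.range_subset_range.2 (by omega)) fun p _ _ => w_nonneg n p
  have hx : 4 ≤ n / Real.log n := by rwa [le_div_iff₀ hl0]
  have hqx : n / Real.log n / 4 ≤ q := by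
    have h1 : n / (2 * Real.log n) < q + 1 := Nat.lt_floor_add_one _
    have h2 : n / (2 * Real.log n) = n / Real.log n / 2 := by
      rw [div_div, mul_comm]
    linarith
  have hPx : (P : ℝ) + 5 ≤ 8 * (n / Real.log n) := by
    have h1 : (P : ℝ) < 2 * n / Real.log n + 1 := Nat.ceil_lt_add_one (by positivity)
    rw [mul_div_assoc] at h1
    linarith
  have hB1 : B (n + 1) (k (n + 1)) ≤ 8 * (n / Real.log n) * B n (k (n + 1)) := by
    have := mul_le_mul_of_nonneg_right hPx hBpos.le
    linarith
  have hB2 : n / Real.log n / 8 * B n (k (n + 1)) ≤ B (n + 1) (k (n + 1)) := by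
    have := mul_le_mul_of_nonneg_right hqx hBpos.le
    linarith
  have hBpos' : 0 < B (n + 1) (k (n + 1)) := lt_of_lt_of_le (by positivity) hB2
  constructor
  · rw [le_div_iff₀ hBpos']
    calc 1 / 8 * Real.log n / n * B (n + 1) (k (n + 1))
        ≤ 1 / 8 * Real.log n / n * (8 * (n / Real.log n) * B n (k (n + 1))) := by gcongr
      _ = B n (k (n + 1)) := by field_simp
  · rw [div_le_iff₀ hBpos']
    calc B n (k (n + 1))
        = 8 * Real.log n / n * (n / Real.log n / 8 * B n (k (n + 1))) := by field_simp
      _ ≤ 8 * Real.log n / n * B (n + 1) (k (n + 1)) := by gcongr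

end CatalanSat
end
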